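/- arXiv:2008.08380 — 2 statements merged into one kernel-verified Lean document; each statement's English description precedes it below -/
import Mathlib

section
/- There exists an absolute constant c > 0 such that the following holds. Let p ≥ 1 and let f be a nonnegative measurable function of a random variable X such that E f(X)^{2p} < ∞ and the distribution of f(X) is atomless. Then for every Δ > 0 and every 0 < κ ≤ 1/2, E_{Q_{1−κ}(f),p}(f) ≤ c·√(Δ·log(1/κ))·‖f(X)‖_{L_{2p}}^p. -/
open MeasureTheory Real

/-- The trimmed mean: discard the `⌈θN⌉` largest values of `z` and average the rest. -/
noncomputable def trimmedMean {N : ℕ} (z : Fin N → ℝ) (θ : ℝ) : ℝ :=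
  (N : ℝ)⁻¹ * ∑ j ∈ Finset.univ.filter
      (fun j : Fin N => (j : ℕ) < N - Nat.ceil (θ * N)), z (Tuple.sort z j)

/-- Empirical measure of a set along the sample `x`. -/
noncomputable def empP {Ω : Type*} {N : ℕ} (x : Fin N → Ω) (s : Set Ω) : ℝ :=
  (N : ℝ)⁻¹ * ∑ i : Fin N, s.indicator (fun _ => (1 : ℝ)) (x i)

/-- Properties (1)-(3) of the sample `x` for the function `f`, with constants `lam`, `C`, `Δ`. -/
def SatisfiesProps {Ω : Type*} [MeasurableSpace Ω] (μ : Measure Ω) (f : Ω → ℝ)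
    {N : ℕ} (x : Fin N → Ω) (lam C Δ : ℝ) : Prop :=
  (∀ t : ℝ, 0 < t → Δ ≤ (μ {ω | t < f ω}).toReal →
    |empP x {ω | t < f ω} / (μ {ω | t < f ω}).toReal - 1| ≤ lam) ∧
  (∀ (j : ℕ) (t : ℝ), 0 < t → Δ ≤ 2 ^ (-(j : ℝ)) * (μ {ω | t < f ω}).toReal →
    |empP x {ω | t < f ω} / (μ {ω | t < f ω}).toReal - 1| ≤ 2 ^ (-(j : ℝ) / 2)) ∧
  (∀ I : Set ℝ, I.OrdConnected →
    empP x {ω | f ω ∈ I} ≤ 3 / 2 * (μ {ω | f ω ∈ I}).toReal + C * Δ)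

/-- `Q_{1-η}(f) = inf {t : P(f > t) < η}`. -/
noncomputable def quant {Ω : Type*} [MeasurableSpace Ω] (μ : Measure Ω) (f : Ω → ℝ)
    (η : ℝ) : ℝ :=
  sInf {t : ℝ | (μ {ω | t < f ω}).toReal < η}

/-- `E_{T,p}(f) = 2√Δ ∫_0^T p t^{p-1} √(P(f>t)) dt`. -/
noncomputable def errE {Ω : Type*} [MeasurableSpace Ω] (μ : Measure Ω) (f : Ω → ℝ)
    (Δ p T : ℝ) : ℝ :=
  2 * Real.sqrt Δ * ∫ t in (0 : ℝ)..T, p * t ^ (p - 1) * Real.sqrt ((μ {ω | t < f ω}).toReal)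

section Tail

variable {Ω : Type*} [MeasurableSpace Ω] {μ : Measure Ω} {f : Ω → ℝ}

theorem antitone_tail (μ : Measure Ω) [IsFiniteMeasure μ] (f : Ω → ℝ) :
    Antitone fun t : ℝ => (μ {ω | t < f ω}).toReal := fun _ _ hst =>
  ENNReal.toReal_mono (measure_ne_top _ _) (measure_mono fun _ hω => lt_of_le_of_lt hst hω)

theorem tail_le_one (μ : Measure Ω) [IsProbabilityMeasure μ] (f : Ω → ℝ) (t : ℝ) :
    (μ {ω | t < f ω}).toReal ≤ 1 :=
  ENNReal.toReal_le_of_le_ofReal zero_le_one (by simpa using prob_le_one)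

theorem nonneg_of_tail_lt [IsProbabilityMeasure μ] (hf : ∀ ω, 0 ≤ f ω) {η : ℝ} (hη : η ≤ 1) :
    ∀ t ∈ {t : ℝ | (μ {ω | t < f ω}).toReal < η}, 0 ≤ t := by
  intro t ht
  by_contra! h
  have : {ω | t < f ω} = Set.univ := Set.eq_univ_of_forall fun ω => h.trans_le (hf ω)
  simp only [Set.mem_ofPred_eq, this, measure_univ, ENNReal.toReal_one] at ht
  linarith

theorem quant_nonneg [IsProbabilityMeasure μ] (hf : ∀ ω, 0 ≤ f ω) {η : ℝ} (hη : η ≤ 1) :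
    0 ≤ quant μ f η :=
  Real.sInf_nonneg (nonneg_of_tail_lt hf hη)

theorem le_tail_of_lt_quant [IsProbabilityMeasure μ] (hf : ∀ ω, 0 ≤ f ω) {η t : ℝ} (hη : η ≤ 1)
    (ht : t < quant μ f η) : η ≤ (μ {ω | t < f ω}).toReal := by
  have := notMem_of_lt_csInf ht ⟨0, nonneg_of_tail_lt hf hη⟩
  simpa using this

theorem rpow_mul_tail_le [IsFiniteMeasure μ] (hf : ∀ ω, 0 ≤ f ω) {q t : ℝ} (hq : 0 ≤ q)
    (ht : 0 ≤ t) (hint : Integrable (fun ω => f ω ^ q) μ) :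
    t ^ q * (μ {ω | t < f ω}).toReal ≤ ∫ ω, f ω ^ q ∂μ := by
  refine le_trans ?_ (mul_meas_ge_le_integral_of_nonneg
    (Filter.Eventually.of_forall fun ω => rpow_nonneg (hf ω) q) hint (t ^ q))
  refine mul_le_mul_of_nonneg_left ?_ (rpow_nonneg ht q)
  exact ENNReal.toReal_mono (measure_ne_top _ _)
    (measure_mono fun ω hω => rpow_le_rpow ht (le_of_lt hω) hq)

/-- A quantile bound from Markov's inequality, in exponential form. -/
theorem quant_le_exp [IsProbabilityMeasure μ] (hf : ∀ ω, 0 ≤ f ω) {q κ : ℝ} (hq : 0 < q)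
    (hκ : 0 < κ) (hκ1 : κ ≤ 1) (hint : Integrable (fun ω => f ω ^ q) μ) :
    quant μ f κ ≤ exp ((log (∫ ω, f ω ^ q ∂μ) + log (1 / κ)) / q) := by
  refine le_of_forall_lt_imp_le_of_dense fun t ht => ?_
  rcases le_or_gt t 0 with h0 | h0
  · exact h0.trans (exp_pos _).le
  have h1 : t ^ q * κ ≤ ∫ ω, f ω ^ q ∂μ :=
    (mul_le_mul_of_nonneg_left (le_tail_of_lt_quant hf hκ1 ht) (rpow_nonneg h0.le q)).trans
      (rpow_mul_tail_le hf hq.le h0.le hint)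
  have h2 := log_le_log (mul_pos (rpow_pos_of_pos h0 q) hκ) h1
  rw [log_mul (rpow_pos_of_pos h0 q).ne' hκ.ne', log_rpow h0] at h2
  rw [← log_le_iff_le_exp h0, le_div_iff₀ hq, one_div, log_inv]
  linarith

theorem intervalIntegrable_rpow_mul_of_le_one {r : ℝ} (hr : 0 ≤ r)
    {g : ℝ → ℝ} (hg : Measurable g) (hg0 : ∀ t, 0 ≤ g t) (hg1 : ∀ t, g t ≤ 1) (a b : ℝ) :
    IntervalIntegrable (fun t => t ^ r * g t) volume a b := by
  refine (intervalIntegral.intervalIntegrable_rpow (μ := volume) (a := a) (b := b)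
    (Or.inl hr)).mono_fun ?_ ?_
  · exact ((measurable_id.pow_const r).mul hg).aestronglyMeasurable
  · refine Filter.Eventually.of_forall fun t => ?_
    simp only [norm_mul]
    refine mul_le_of_le_one_right (norm_nonneg _) ?_
    rw [Real.norm_of_nonneg (hg0 t)]
    exact hg1 t

/-- Truncated layer-cake inequality. -/
theorem integral_rpow_mul_tail_le [IsProbabilityMeasure μ] (hfm : Measurable f)
    (hf : ∀ ω, 0 ≤ f ω) {q a b : ℝ} (hq : 1 ≤ q) (ha : 0 ≤ a) (hab : a ≤ b)
    (hint : Integrable (fun ω => f ω ^ q) μ) :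
    q * ∫ t in a..b, t ^ (q - 1) * (μ {ω | t < f ω}).toReal ≤ ∫ ω, f ω ^ q ∂μ := by
  have hq0 : 0 < q := by linarith
  have hii := intervalIntegrable_rpow_mul_of_le_one (r := q - 1) (by linarith)
    (antitone_tail μ f).measurable (fun _ => ENNReal.toReal_nonneg) (tail_le_one μ f) a b
  have hcake := lintegral_rpow_eq_lintegral_meas_lt_mul μ
    (Filter.Eventually.of_forall hf) hfm.aemeasurable hq0
  rw [← ofReal_integral_eq_lintegral_ofReal hint
    (Filter.Eventually.of_forall fun ω => rpow_nonneg (hf ω) q)] at hcake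
  rw [← ENNReal.ofReal_le_ofReal_iff (integral_nonneg fun ω => rpow_nonneg (hf ω) q), hcake,
    ENNReal.ofReal_mul hq0.le, intervalIntegral.integral_of_le hab,
    ofReal_integral_eq_lintegral_ofReal
      ((intervalIntegrable_iff_integrableOn_Ioc_of_le hab).1 hii)]
  · refine mul_le_mul_right ?_ _
    calc _ = ∫⁻ t in Set.Ioc a b, μ {ω | t < f ω} * ENNReal.ofReal (t ^ (q - 1)) := by
          refine setLIntegral_congr_fun measurableSet_Ioc fun t ht => ?_
          rw [ENNReal.ofReal_mul (rpow_nonneg (ha.trans ht.1.le) _),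
            ENNReal.ofReal_toReal (measure_ne_top _ _), mul_comm]
      _ ≤ _ := lintegral_mono_set fun t ht => ha.trans_lt ht.1
  · refine (ae_restrict_iff' measurableSet_Ioc).2 (Filter.Eventually.of_forall fun t ht => ?_)
    exact mul_nonneg (rpow_nonneg (ha.trans ht.1.le) _) ENNReal.toReal_nonneg

/-- The contribution of small `t`, where the tail is only bounded by `1`. -/
theorem integral_sqrt_tail_le_rpow [IsProbabilityMeasure μ] {p b : ℝ} (hp : 1 ≤ p) (hb : 0 ≤ b) :
    ∫ t in (0 : ℝ)..b, t ^ (p - 1) * √(μ {ω | t < f ω}).toReal ≤ b ^ p / p := by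
  have hr : 0 ≤ p - 1 := by linarith
  calc _ ≤ ∫ t in (0 : ℝ)..b, t ^ (p - 1) := by
        refine intervalIntegral.integral_mono_on hb
          (intervalIntegrable_rpow_mul_of_le_one hr
            (antitone_tail μ f).measurable.sqrt (fun _ => sqrt_nonneg _)
            (fun t => sqrt_le_one.2 (tail_le_one μ f t)) _ _)
          (intervalIntegral.intervalIntegrable_rpow (Or.inl hr)) fun t ht => ?_
        exact mul_le_of_le_one_right (rpow_nonneg ht.1 _) (sqrt_le_one.2 (tail_le_one μ f t))
    _ = b ^ p / p := by
        rw [integral_rpow (Or.inl (by linarith)), sub_add_cancel, zero_rpow (by linarith), sub_zero]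

/-- The contribution of large `t`, by a weighted arithmetic-geometric mean inequality. -/
theorem integral_sqrt_tail_le_log [IsProbabilityMeasure μ] (hfm : Measurable f)
    (hf : ∀ ω, 0 ≤ f ω) {p a b s : ℝ} (hp : 1 ≤ p) (ha : 0 < a) (hab : a ≤ b) (hs : 0 < s)
    (hint : Integrable (fun ω => f ω ^ (2 * p)) μ) :
    p * ∫ t in a..b, t ^ (p - 1) * √(μ {ω | t < f ω}).toReal ≤
      s * (∫ ω, f ω ^ (2 * p) ∂μ) / 4 + p * log (b / a) / (2 * s) := by
  have hr : 0 ≤ p - 1 := by linarith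
  have hb : 0 < b := ha.trans_le hab
  have hii1 := intervalIntegrable_rpow_mul_of_le_one hr
    (antitone_tail μ f).measurable.sqrt (fun _ => sqrt_nonneg _)
    (fun t => sqrt_le_one.2 (tail_le_one μ f t)) a b
  have hii2 := intervalIntegrable_rpow_mul_of_le_one (r := 2 * p - 1) (by linarith)
    (antitone_tail μ f).measurable (fun _ => ENNReal.toReal_nonneg) (tail_le_one μ f) a b
  have h0 : (0 : ℝ) ∉ Set.uIcc a b := by
    rw [Set.uIcc_of_le hab]
    exact fun h => ha.not_ge h.1
  have hii3 : IntervalIntegrable (fun t : ℝ => t⁻¹) volume a b :=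
    intervalIntegrable_inv_iff.2 (Or.inr h0)
  have hamgm : ∫ t in a..b, t ^ (p - 1) * √(μ {ω | t < f ω}).toReal ≤
      ∫ t in a..b, (s / 2 * (t ^ (2 * p - 1) * (μ {ω | t < f ω}).toReal) + 1 / (2 * s) * t⁻¹) := by
    refine intervalIntegral.integral_mono_on hab hii1
      ((hii2.const_mul _).add (hii3.const_mul _)) fun t ht => ?_
    have ht0 : 0 < t := ha.trans_le ht.1
    set P := (μ {ω | t < f ω}).toReal
    have hP : P = √P * √P := (mul_self_sqrt ENNReal.toReal_nonneg).symm
    have h1 : t ^ (2 * p - 1) = t ^ (p - 1) * t ^ (p - 1) * t := by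
      rw [← rpow_add ht0, ← rpow_add_one ht0.ne']
      ring_nf
    have h2 : s / 2 * (t ^ (2 * p - 1) * (√P * √P)) + 1 / (2 * s) * t⁻¹ - t ^ (p - 1) * √P =
        (s * t * (t ^ (p - 1) * √P) - 1) ^ 2 / (2 * s * t) := by
      rw [h1]
      field_simp
      ring
    have h3 : 0 ≤ (s * t * (t ^ (p - 1) * √P) - 1) ^ 2 / (2 * s * t) := by positivity
    rw [← h2, ← hP] at h3
    linarith
  rw [intervalIntegral.integral_add (hii2.const_mul _) (hii3.const_mul _),
    intervalIntegral.integral_const_mul, intervalIntegral.integral_const_mul,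
    integral_inv h0] at hamgm
  have hcake := integral_rpow_mul_tail_le hfm hf (by linarith : 1 ≤ 2 * p) ha.le hab hint
  calc _ ≤ p * _ := mul_le_mul_of_nonneg_left hamgm (by linarith)
    _ = s / 4 * (2 * p * ∫ t in a..b, t ^ (2 * p - 1) * (μ {ω | t < f ω}).toReal) +
        p * log (b / a) / (2 * s) := by ring
    _ ≤ s / 4 * (∫ ω, f ω ^ (2 * p) ∂μ) + p * log (b / a) / (2 * s) := by gcongr
    _ = _ := by ring

theorem integral_rpow_pos [IsProbabilityMeasure μ] (hf : ∀ ω, 0 ≤ f ω) {q : ℝ} (hq : q ≠ 0)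
    (hint : Integrable (fun ω => f ω ^ q) μ) (hzero : μ {ω | f ω = 0} = 0) :
    0 < ∫ ω, f ω ^ q ∂μ := by
  refine lt_of_le_of_ne (integral_nonneg fun ω => rpow_nonneg (hf ω) q) fun h => ?_
  have hae := (integral_eq_zero_iff_of_nonneg (fun ω => rpow_nonneg (hf ω) q) hint).1 h.symm
  have h0 : ∀ᵐ ω ∂μ, f ω ≠ 0 := by simpa [ae_iff] using hzero
  have : ∀ᵐ _ ∂μ, False := by
    filter_upwards [hae, h0] with ω h1 h2
    exact h2 ((rpow_eq_zero (hf ω) hq).1 h1)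
  exact this.exists.choose_spec

theorem integral_sqrt_tail_quant_le [IsProbabilityMeasure μ] (hfm : Measurable f)
    (hf : ∀ ω, 0 ≤ f ω) {p κ : ℝ} (hp : 1 ≤ p) (hκ : 0 < κ) (hκ1 : κ < 1)
    (hint : Integrable (fun ω => f ω ^ (2 * p)) μ) (hM : 0 < ∫ ω, f ω ^ (2 * p) ∂μ) :
    p * ∫ t in (0 : ℝ)..quant μ f κ, t ^ (p - 1) * √(μ {ω | t < f ω}).toReal ≤
      √(∫ ω, f ω ^ (2 * p) ∂μ) * (1 + √(log (1 / κ)) / 2) := by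
  have hp0 : 0 < p := by linarith
  have hT0 := quant_nonneg (μ := μ) hf hκ1.le
  have hT := quant_le_exp hf (by linarith : 0 < 2 * p) hκ hκ1.le hint
  have hL : 0 < log (1 / κ) := log_pos (by rw [lt_div_iff₀ hκ]; linarith)
  set M := ∫ ω, f ω ^ (2 * p) ∂μ
  set L := log (1 / κ)
  set T := quant μ f κ
  set a := M ^ (1 / (2 * p)) with ha_def
  have ha : 0 < a := rpow_pos_of_pos hM _
  have hap : a ^ p = √M := by
    rw [ha_def, ← rpow_mul hM.le, sqrt_eq_rpow]
    congr 1
    field_simp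
  have hsmall : ∀ b, 0 ≤ b → b ≤ a →
      p * ∫ t in (0 : ℝ)..b, t ^ (p - 1) * √(μ {ω | t < f ω}).toReal ≤ √M := fun b hb hba => by
    have h := mul_le_mul_of_nonneg_left (integral_sqrt_tail_le_rpow (μ := μ) (f := f) hp hb) hp0.le
    rw [mul_div_cancel₀ _ hp0.ne'] at h
    exact h.trans (hap ▸ rpow_le_rpow hb hba hp0.le)
  rcases le_total T a with hTa | haT
  · refine (hsmall T hT0 hTa).trans (le_mul_of_one_le_right (sqrt_nonneg _) ?_)
    linarith [sqrt_nonneg L]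
  have hii := intervalIntegrable_rpow_mul_of_le_one (r := p - 1) (by linarith)
    (antitone_tail μ f).measurable.sqrt (fun _ => sqrt_nonneg _)
    (fun t => sqrt_le_one.2 (tail_le_one μ f t))
  rw [← intervalIntegral.integral_add_adjacent_intervals (hii 0 a) (hii a T), mul_add]
  have hsM : 0 < √M := sqrt_pos.2 hM
  have hsL : 0 < √L := sqrt_pos.2 hL
  have hlarge := integral_sqrt_tail_le_log hfm hf hp ha haT (div_pos hsL hsM) hint
  have hTpos : 0 < T := ha.trans_le haT
  have hlog : p * log (T / a) ≤ L / 2 := by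
    have h1 := (log_le_iff_le_exp hTpos).2 hT
    rw [log_div hTpos.ne' ha.ne', ha_def, log_rpow hM]
    calc _ ≤ p * ((log M + L) / (2 * p) - 1 / (2 * p) * log M) := by gcongr
      _ = L / 2 := by field_simp; ring
  have hbound : √L / √M * M / 4 + p * log (T / a) / (2 * (√L / √M)) ≤ √M * (√L / 2) := by
    calc _ ≤ √L / √M * M / 4 + L / 2 / (2 * (√L / √M)) := by gcongr
      _ = √L / √M * (√M ^ 2) / 4 + √L ^ 2 / 2 / (2 * (√L / √M)) := by
          rw [sq_sqrt hM.le, sq_sqrt hL.le]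
      _ = _ := by field_simp; ring
  linarith [hsmall a ha.le le_rfl]

end Tail

theorem errE_bound_L2p :
    ∃ c : ℝ, 0 < c ∧
    ∀ (Ω : Type) (_ : MeasurableSpace Ω) (μ : Measure Ω), IsProbabilityMeasure μ →
    ∀ (p : ℝ), 1 ≤ p →
    ∀ (f : Ω → ℝ), Measurable f → (∀ ω, 0 ≤ f ω) →
    Integrable (fun ω => f ω ^ (2 * p)) μ →
    (∀ t : ℝ, μ {ω | f ω = t} = 0) →
    ∀ (Δ : ℝ), 0 < Δ →
    ∀ (κ : ℝ), 0 < κ → κ ≤ 1 / 2 →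
    errE μ f Δ p (quant μ f κ) ≤
      c * Real.sqrt (Δ * Real.log (1 / κ)) * (∫ ω, f ω ^ (2 * p) ∂μ) ^ ((1 : ℝ) / 2) := by
  refine ⟨5, by norm_num, ?_⟩
  intro Ω _ μ _ p hp f hfm hf hint hatom Δ hΔ κ hκ hκ2
  have hM := integral_rpow_pos hf (by linarith : 2 * p ≠ 0) hint (hatom 0)
  have hmain := integral_sqrt_tail_quant_le hfm hf hp hκ (by linarith) hint hM
  have hL : 1 ≤ 2 * √(log (1 / κ)) := by
    have h1 : log 2 ≤ log (1 / κ) :=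
      log_le_log two_pos (by rw [le_div_iff₀ hκ]; linarith)
    have h2 : (1 / 2 : ℝ) ≤ √(log (1 / κ)) :=
      le_sqrt_of_sq_le (by linarith [log_two_gt_d9])
    linarith
  have hint_eq : ∫ t in (0 : ℝ)..quant μ f κ, p * t ^ (p - 1) * √(μ {ω | t < f ω}).toReal =
      p * ∫ t in (0 : ℝ)..quant μ f κ, t ^ (p - 1) * √(μ {ω | t < f ω}).toReal := by
    simp only [mul_assoc, intervalIntegral.integral_const_mul]
  rw [errE, hint_eq, ← sqrt_eq_rpow, sqrt_mul hΔ.le]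
  calc _ ≤ 2 * √Δ * (√(∫ ω, f ω ^ (2 * p) ∂μ) * (1 + √(log (1 / κ)) / 2)) := by gcongr
    _ ≤ 2 * √Δ * (√(∫ ω, f ω ^ (2 * p) ∂μ) * (5 / 2 * √(log (1 / κ)))) := by
        gcongr
        linarith
    _ = _ := by ring
end

section
/- Let p ≥ 1 and let f be a nonnegative measurable function of a random variable X such that E f(X)^p < ∞ and the distribution of f(X) is atomless. Let 0 ≤ λ < 1, C ≥ 1, 0 < Δ < 1, and let x_1,…,x_N satisfy Properties (1)–(3) for f with constants λ, C, Δ. Let θ satisfy 4Δ·max{1+λ, C+3/2} ≤ θ < 1, and set θ₁ = (θ + 2CΔ)/(1−λ), assumed to satisfy θ₁ < 1. Then (1/N)·Σ_{j ≥ θN} (f(x_i)^p)_j^* ≥ E f(X)^p − (1 + 1/(1−λ))·E[f(X)^p · 1_{f(X) ≥ Q_{1−θ₁}(f)}] − 2√Δ·∫_0^{Q_{1−θ₁}(f)} p·t^{p−1}·√(P(f > t)) dt, where the trimmed mean on the left is the sum of the values f(x_i)^p after discarding the ⌈θN⌉ largest ones, divided by N. -/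
open MeasureTheory Real

theorem integral_min_rpow_eq_intervalIntegral_measureReal {α : Type*} [MeasurableSpace α]
    (ν : Measure α) [IsFiniteMeasure ν] {g : α → ℝ} (hg : Measurable g) (hg0 : ∀ a, 0 ≤ g a)
    {p : ℝ} (hp : 0 < p) {T : ℝ} (hT : 0 ≤ T) :
    ∫ a, min (g a) T ^ p ∂ν = ∫ t in (0 : ℝ)..T, p * t ^ (p - 1) * ν.real {a | t < g a} := by
  have hmin : Measurable fun a => min (g a) T := hg.min measurable_const
  have hanti : Antitone fun t => ν.real {a | t < g a} := fun s t hst =>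
    measureReal_mono fun a (ha : t < g a) => hst.trans_lt ha
  rw [integral_eq_lintegral_of_nonneg_ae
      (Filter.Eventually.of_forall fun a => rpow_nonneg (le_min (hg0 a) hT) p)
      (hmin.pow_const p).aestronglyMeasurable,
    lintegral_rpow_eq_lintegral_meas_lt_mul ν
      (Filter.Eventually.of_forall fun a => le_min (hg0 a) hT) hmin.aemeasurable hp,
    intervalIntegral.integral_of_le hT, integral_eq_lintegral_of_nonneg_ae]
  · congr 1
    rw [← lintegral_const_mul' _ _ ENNReal.ofReal_ne_top,
      ← setLIntegral_congr Ioo_ae_eq_Ioc, ← lintegral_indicator measurableSet_Ioi,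
      ← lintegral_indicator measurableSet_Ioo]
    refine lintegral_congr fun t => ?_
    by_cases h0 : 0 < t
    · by_cases hlt : t < T
      · have h1 : 0 ≤ p * t ^ (p - 1) := by positivity
        simp only [Set.indicator, Set.mem_Ioi, Set.mem_Ioo, h0, hlt, and_self, if_true, lt_min_iff,
          and_true]
        rw [ENNReal.ofReal_mul h1, ENNReal.ofReal_mul hp.le, ofReal_measureReal]
        ring
      · simp [Set.indicator, h0, hlt]
    · simp [Set.indicator, h0]
  · refine (ae_restrict_mem measurableSet_Ioc).mono fun t ht => ?_
    have := ht.1.le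
    positivity
  · exact (((measurable_id.pow_const (p - 1)).const_mul p).mul
      hanti.measurable).aestronglyMeasurable

theorem sum_filter_le_sum_sort {N : ℕ} (z : Fin N → ℝ) (hz : ∀ i, 0 ≤ z i) (c : ℝ) {m : ℕ}
    (hm : m ≤ (Finset.univ.filter fun i => c < z i).card) :
    ∑ i ∈ Finset.univ.filter (fun i => z i ≤ c), z i ≤
      ∑ j ∈ Finset.univ.filter (fun j : Fin N => (j : ℕ) < N - m), z (Tuple.sort z j) := by
  have hperm : ∑ i ∈ Finset.univ.filter (fun i => z i ≤ c), z i =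
      ∑ j ∈ Finset.univ.filter (fun j => z (Tuple.sort z j) ≤ c), z (Tuple.sort z j) := by
    rw [Finset.sum_filter, Finset.sum_filter,
      Equiv.sum_comp (Tuple.sort z) fun i => if z i ≤ c then z i else 0]
  have hcard : (Finset.univ.filter fun i => c < z i).card =
      (Finset.univ.filter fun j => c < z (Tuple.sort z j)).card := by
    rw [Finset.card_filter, Finset.card_filter,
      Equiv.sum_comp (Tuple.sort z) fun i => if c < z i then 1 else 0]
  rw [hperm]
  refine Finset.sum_le_sum_of_subset_of_nonneg (fun j hj => ?_) fun _ _ _ => hz _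
  simp only [Finset.mem_filter, Finset.mem_univ, true_and] at hj ⊢
  have hsub : (Finset.univ.filter fun j => c < z (Tuple.sort z j)) ⊆ Finset.Ioi j := by
    intro i hi
    simp only [Finset.mem_filter, Finset.mem_univ, true_and, Finset.mem_Ioi] at hi ⊢
    by_contra! hij
    exact absurd (Tuple.monotone_sort z hij) (by simpa using hj.trans_lt hi)
  have := Finset.card_le_card hsub
  rw [Fin.card_Ioi] at this
  have := j.isLt
  omega

theorem empP_eq_card {Ω : Type*} {N : ℕ} (x : Fin N → Ω) (f : Ω → ℝ) (t : ℝ) :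
    empP x {ω | t < f ω} = (N : ℝ)⁻¹ * ((Finset.univ.filter fun i => t < f (x i)).card : ℝ) := by
  simp [empP, Set.indicator_apply]

theorem exists_lt_of_lt_measureReal_lt {Ω : Type*} [MeasurableSpace Ω] (μ : Measure Ω)
    [IsFiniteMeasure μ] {f : Ω → ℝ} {a η : ℝ} (h : η < μ.real {ω | a < f ω}) :
    ∃ t, a < t ∧ η < μ.real {ω | t < f ω} := by
  obtain ⟨u, hu, hua, hlim⟩ := exists_seq_strictAnti_tendsto a
  have hmono : Monotone fun n => {ω | u n < f ω} := fun m n hmn ω (hω : u m < f ω) =>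
    (hu.antitone hmn).trans_lt hω
  have hU : ⋃ n, {ω | u n < f ω} = {ω | a < f ω} := by
    ext ω
    simp only [Set.mem_iUnion, Set.mem_ofPred_eq]
    exact ⟨fun ⟨n, hn⟩ => (hua n).trans hn, fun hω => (hlim.eventually_lt_const hω).exists⟩
  have ht := tendsto_measure_iUnion_atTop (μ := μ) hmono
  rw [hU] at ht
  have ht' := (ENNReal.tendsto_toReal (measure_ne_top μ _)).comp ht
  obtain ⟨n, hn⟩ := (ht'.eventually_const_lt h).exists
  exact ⟨u n, hua n, hn⟩

theorem le_measureReal_of_forall_lt {Ω : Type*} [MeasurableSpace Ω] (μ : Measure Ω)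
    [IsFiniteMeasure μ] {f : Ω → ℝ} (hf : Measurable f) {a η : ℝ}
    (h : ∀ t < a, η ≤ μ.real {ω | t < f ω}) : η ≤ μ.real {ω | a ≤ f ω} := by
  obtain ⟨u, hu, hua, hlim⟩ := exists_seq_strictMono_tendsto a
  have hanti : Antitone fun n => {ω | u n < f ω} := fun m n hmn ω (hω : u n < f ω) =>
    (hu.monotone hmn).trans_lt hω
  have hI : ⋂ n, {ω | u n < f ω} = {ω | a ≤ f ω} := by
    ext ω
    simp only [Set.mem_iInter, Set.mem_ofPred_eq]
    exact ⟨fun hω => le_of_tendsto' hlim fun n => (hω n).le, fun hω n => (hua n).trans_le hω⟩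
  have ht := tendsto_measure_iInter_atTop (μ := μ)
    (fun n => (measurableSet_lt measurable_const hf).nullMeasurableSet) hanti
    ⟨0, measure_ne_top μ _⟩
  rw [hI] at ht
  exact ge_of_tendsto' ((ENNReal.tendsto_toReal (measure_ne_top μ _)).comp ht)
    fun n => h _ (hua n)

theorem exists_measureReal_lt_lt {Ω : Type*} [MeasurableSpace Ω] (μ : Measure Ω)
    [IsFiniteMeasure μ] {f : Ω → ℝ} (hf : Measurable f) {η : ℝ} (hη : 0 < η) :
    ∃ t, μ.real {ω | t < f ω} < η := by
  have hanti : Antitone fun n : ℕ => {ω | (n : ℝ) < f ω} := fun m n hmn ω (hω : (n : ℝ) < f ω) =>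
    (Nat.cast_le.2 hmn).trans_lt hω
  have hI : ⋂ n : ℕ, {ω | (n : ℝ) < f ω} = ∅ := by
    ext ω
    simp only [Set.mem_iInter, Set.mem_ofPred_eq, Set.mem_empty_iff_false, iff_false, not_forall,
      not_lt]
    exact exists_nat_ge _
  have ht := tendsto_measure_iInter_atTop (μ := μ)
    (fun n => (measurableSet_lt measurable_const hf).nullMeasurableSet) hanti
    ⟨0, measure_ne_top μ _⟩
  rw [hI, measure_empty] at ht
  have ht' := (ENNReal.tendsto_toReal ENNReal.zero_ne_top).comp ht
  obtain ⟨n, hn⟩ := (ht'.eventually_lt_const (by simpa using hη)).exists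
  exact ⟨n, hn⟩

theorem sub_le_of_abs_div_sub_one_le {F e Δ : ℝ} (hΔ : 0 < Δ) (hF : Δ ≤ F)
    (h : ∀ j : ℕ, Δ ≤ 2 ^ (-(j : ℝ)) * F → |e / F - 1| ≤ 2 ^ (-(j : ℝ) / 2)) :
    F - 2 * √Δ * √F ≤ e := by
  have hF0 : 0 < F := hΔ.trans_le hF
  obtain ⟨n, hn, hn'⟩ := exists_nat_pow_near ((one_le_div hΔ).2 hF) one_lt_two
  rw [le_div_iff₀ hΔ] at hn
  rw [div_lt_iff₀ hΔ, pow_succ] at hn'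
  have hpow : (0 : ℝ) < 2 ^ n := by positivity
  have hneg : (2 : ℝ) ^ (-(n : ℝ)) = (2 ^ n)⁻¹ := by rw [rpow_neg two_pos.le, rpow_natCast]
  have hd := h n (by rw [hneg, inv_mul_eq_div, le_div_iff₀ hpow]; linarith)
  set d : ℝ := 2 ^ (-(n : ℝ) / 2) with hd_def
  have hsq : d ^ 2 = (2 ^ n)⁻¹ := by
    rw [hd_def, ← rpow_natCast, ← rpow_mul two_pos.le, ← hneg]
    congr 1
    push_cast
    ring
  have he : F - d * F ≤ e := by
    have h1 := (abs_le.1 hd).1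
    have h2 : 1 - d ≤ e / F := by linarith
    rw [le_div_iff₀ hF0] at h2
    linarith
  have hdF : d * F ≤ 2 * √Δ * √F := by
    refine le_of_sq_le_sq ?_ (by positivity)
    rw [mul_pow, mul_pow, mul_pow, sq_sqrt hΔ.le, sq_sqrt hF0.le, hsq, inv_mul_eq_div,
      div_le_iff₀ hpow]
    nlinarith [mul_pos hF0 hpow]
  linarith

theorem trimmed_mean_lower_bound_general
    (Ω : Type) [MeasurableSpace Ω] (μ : Measure Ω) [IsProbabilityMeasure μ]
    (p : ℝ) (hp : 1 ≤ p)
    (f : Ω → ℝ) (hmeas : Measurable f) (hnonneg : ∀ ω, 0 ≤ f ω)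
    (hint : Integrable (fun ω => f ω ^ p) μ)
    (hatomless : ∀ t : ℝ, μ {ω | f ω = t} = 0)
    (lam C Δ : ℝ) (hlam0 : 0 ≤ lam) (hlam1 : lam < 1) (hC : 1 ≤ C)
    (hΔ0 : 0 < Δ) (hΔ1 : Δ < 1)
    (N : ℕ) (x : Fin N → Ω) (hprops : SatisfiesProps μ f x lam C Δ)
    (θ : ℝ) (hθlow : 4 * Δ * max (1 + lam) (C + 3 / 2) ≤ θ) (hθhigh : θ < 1)
    (hθ₁ : (θ + 2 * C * Δ) / (1 - lam) < 1) :
    trimmedMean (fun i => f (x i) ^ p) θ ≥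
      (∫ ω, f ω ^ p ∂μ)
      - (1 + 1 / (1 - lam)) *
          (∫ ω in {ω | quant μ f ((θ + 2 * C * Δ) / (1 - lam)) ≤ f ω}, f ω ^ p ∂μ)
      - errE μ f Δ p (quant μ f ((θ + 2 * C * Δ) / (1 - lam))) := by
  obtain ⟨hprop₁, hprop₂, -⟩ := hprops
  set η := (θ + 2 * C * Δ) / (1 - lam) with hη
  set T := quant μ f η
  change ∀ t : ℝ, 0 < t → Δ ≤ μ.real {ω | t < f ω} →
    |empP x {ω | t < f ω} / μ.real {ω | t < f ω} - 1| ≤ lam at hprop₁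
  change ∀ (j : ℕ) (t : ℝ), 0 < t → Δ ≤ 2 ^ (-(j : ℝ)) * μ.real {ω | t < f ω} →
    |empP x {ω | t < f ω} / μ.real {ω | t < f ω} - 1| ≤ 2 ^ (-(j : ℝ) / 2) at hprop₂
  have hp0 : 0 < p := by linarith
  have hlam : 0 < 1 - lam := by linarith
  have hθΔ : 4 * Δ ≤ θ := by
    have := le_max_left (1 + lam) (C + 3 / 2)
    nlinarith
  have hηθ : η * (1 - lam) = θ + 2 * C * Δ := div_mul_cancel₀ _ hlam.ne'
  have hCΔ : 0 < C * Δ := by positivity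
  have hη0 : 0 < η := div_pos (by linarith) hlam
  have hηΔ : Δ ≤ η := by nlinarith
  have hanti : Antitone fun t => μ.real {ω | t < f ω} := fun s t hst =>
    measureReal_mono fun ω (hω : t < f ω) => hst.trans_lt hω
  have hgt_ge : ∀ t, μ.real {ω | t < f ω} = μ.real {ω | t ≤ f ω} := by
    refine fun t => measureReal_congr ?_
    have : ∀ᵐ ω ∂μ, f ω ≠ t := by
      rw [ae_iff]
      simpa using hatomless t
    refine Filter.eventuallyEq_set.2 (this.mono fun ω hω => ?_)
    exact ⟨fun (h : t < f ω) => h.le, fun (h : t ≤ f ω) => h.lt_of_ne hω.symm⟩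
  have hzero : μ.real {ω | 0 < f ω} = 1 := by
    rw [hgt_ge]
    simp [hnonneg]
  obtain ⟨s, hs0, hs⟩ := exists_lt_of_lt_measureReal_lt μ (hθ₁.trans_eq hzero.symm)
  have hsT : ∀ t, t ∈ {t : ℝ | (μ {ω | t < f ω}).toReal < η} → s ≤ t := fun t ht => by
    by_contra! hts
    exact absurd (hs.trans_le (hanti hts.le)) (not_lt.2 (le_of_lt ht))
  have hT : 0 < T := hs0.trans_le (le_csInf (exists_measureReal_lt_lt μ hmeas hη0) hsT)
  have hlow : ∀ t < T, η ≤ μ.real {ω | t < f ω} := fun t ht => by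
    by_contra! h
    exact absurd (csInf_le ⟨s, hsT⟩ h) (not_le.2 ht)
  have hq : η ≤ μ.real {ω | T < f ω} := by
    rw [hgt_ge]
    exact le_measureReal_of_forall_lt μ hmeas hlow
  set q := μ.real {ω | T < f ω} with hq_def
  have hq0 : 0 < q := hη0.trans_le hq
  obtain ⟨hemp₁, hemp₂⟩ := abs_le.1 (hprop₁ T hT (hηΔ.trans hq))
  have hemp_ge : (1 - lam) * q ≤ empP x {ω | T < f ω} := by
    rw [← le_div_iff₀ hq0]
    linarith
  have hemp_le : empP x {ω | T < f ω} ≤ (1 + lam) * q := by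
    rw [← div_le_iff₀ hq0]
    linarith
  have hcard : ⌈θ * N⌉₊ ≤ (Finset.univ.filter fun i => T ^ p < f (x i) ^ p).card := by
    have hfilter : (Finset.univ.filter fun i => T ^ p < f (x i) ^ p) =
        Finset.univ.filter fun i => T < f (x i) :=
      Finset.filter_congr fun i _ => rpow_lt_rpow_iff hT.le (hnonneg _) hp0
    rw [hfilter, Nat.ceil_le]
    have hθemp : θ ≤ empP x {ω | T < f ω} := by nlinarith
    rw [empP_eq_card] at hθemp
    rcases N.eq_zero_or_pos with hN | hN
    · subst hN
      simp
    · rwa [inv_mul_eq_div, le_div_iff₀ (by exact_mod_cast hN)] at hθemp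
  have htrim := sum_filter_le_sum_sort (fun i => f (x i) ^ p)
    (fun i => rpow_nonneg (hnonneg _) p) (T ^ p) hcard
  have hsplit : ∑ i, min (f (x i)) T ^ p =
      ∑ i ∈ Finset.univ.filter (fun i => f (x i) ^ p ≤ T ^ p), f (x i) ^ p +
        T ^ p * ((Finset.univ.filter fun i => T < f (x i)).card : ℝ) := by
    rw [Finset.card_filter, Nat.cast_sum, Finset.mul_sum, Finset.sum_filter,
      ← Finset.sum_add_distrib]
    refine Finset.sum_congr rfl fun i _ => ?_
    simp only [rpow_le_rpow_iff (hnonneg (x i)) hT.le hp0]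
    rcases le_or_gt (f (x i)) T with h | h
    · simp [h, not_lt.2 h]
    · simp [h.le, h, not_le.2 h]
  have hsample : (N : ℝ)⁻¹ * ∑ i, min (f (x i)) T ^ p =
      ∫ t in (0 : ℝ)..T, p * t ^ (p - 1) * empP x {ω | t < f ω} := by
    have h := integral_min_rpow_eq_intervalIntegral_measureReal Measure.count
      (g := fun i => f (x i)) (measurable_of_finite _) (fun i => hnonneg _) hp0 hT.le
    rw [integral_count] at h
    rw [h, ← intervalIntegral.integral_const_mul]
    refine intervalIntegral.integral_congr fun t _ => ?_
    have hc : Measure.count.real {i | t < f (x i)} =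
        ((Finset.univ.filter fun i => t < f (x i)).card : ℝ) := by
      rw [measureReal_def, Measure.count_apply_finite _ (Set.toFinite _)]
      simp
    simp only [hc, empP_eq_card]
    ring
  have hpop := integral_min_rpow_eq_intervalIntegral_measureReal μ hmeas hnonneg hp0 hT.le
  have hcont : Continuous fun t : ℝ => p * t ^ (p - 1) :=
    continuous_const.mul (continuous_id.rpow_const fun _ => Or.inr (by linarith))
  have hintF : IntervalIntegrable (fun t => p * t ^ (p - 1) * μ.real {ω | t < f ω}) volume 0 T :=
    (hanti.intervalIntegrable).continuousOn_mul hcont.continuousOn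
  have hintsqrt : IntervalIntegrable
      (fun t => p * t ^ (p - 1) * √(μ.real {ω | t < f ω})) volume 0 T := by
    have : Antitone fun t => √(μ.real {ω | t < f ω}) := fun s t hst => sqrt_le_sqrt (hanti hst)
    exact this.intervalIntegrable.continuousOn_mul hcont.continuousOn
  have hintE : IntervalIntegrable (fun t => p * t ^ (p - 1) * empP x {ω | t < f ω}) volume 0 T := by
    have : Antitone fun t => empP x {ω | t < f ω} := fun s t hst => by
      simp only [empP_eq_card]
      gcongr
    exact this.intervalIntegrable.continuousOn_mul hcont.continuousOn
  have hcompare : ∫ ω, min (f ω) T ^ p ∂μ - errE μ f Δ p T ≤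
      (N : ℝ)⁻¹ * ∑ i, min (f (x i)) T ^ p := by
    rw [hsample, hpop, errE, ← intervalIntegral.integral_const_mul]
    change _ - ∫ t in (0 : ℝ)..T, 2 * √Δ * (p * t ^ (p - 1) * √(μ.real {ω | t < f ω})) ≤ _
    rw [← intervalIntegral.integral_sub hintF (hintsqrt.const_mul _)]
    refine intervalIntegral.integral_mono_on_of_le_Ioo hT.le (hintF.sub (hintsqrt.const_mul _))
      hintE fun t ht => ?_
    have hdev := sub_le_of_abs_div_sub_one_le hΔ0 (hηΔ.trans (hlow t ht.2))
      fun j => hprop₂ j t ht.1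
    have hw : 0 ≤ p * t ^ (p - 1) := by
      have := ht.1.le
      positivity
    nlinarith [mul_le_mul_of_nonneg_left hdev hw]
  set S := {ω | T ≤ f ω} with hS
  have hSm : MeasurableSet S := measurableSet_le measurable_const hmeas
  have hSq : μ.real S = q := (hgt_ge T).symm
  have hmin : ∫ ω, min (f ω) T ^ p ∂μ =
      ∫ ω, f ω ^ p ∂μ - ∫ ω in S, f ω ^ p ∂μ + T ^ p * q := by
    have hpw : (fun ω => min (f ω) T ^ p) =
        fun ω => f ω ^ p - S.indicator (fun ω => f ω ^ p) ω + S.indicator (fun _ => T ^ p) ω := by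
      ext ω
      by_cases h : T ≤ f ω
      · simp [hS, h]
      · simp [hS, h, (not_le.1 h).le]
    have hadd := integral_add (hint.sub (hint.indicator hSm))
      ((integrable_const (T ^ p)).indicator hSm)
    simp only [Pi.sub_apply] at hadd
    rw [hpw, hadd, integral_sub hint (hint.indicator hSm), integral_indicator hSm, integral_indicator hSm,
      setIntegral_const, hSq, smul_eq_mul, mul_comm q]
  have htail : T ^ p * q ≤ ∫ ω in S, f ω ^ p ∂μ := by
    rw [← hSq]
    exact setIntegral_ge_of_const_le_real hSm (measure_ne_top _ _)
      (fun ω hω => rpow_le_rpow hT.le hω hp0.le) hint.integrableOn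
  have htrimmed : (N : ℝ)⁻¹ * ∑ i, min (f (x i)) T ^ p - T ^ p * empP x {ω | T < f ω} ≤
      trimmedMean (fun i => f (x i) ^ p) θ := by
    have := mul_le_mul_of_nonneg_left htrim (inv_nonneg.2 (Nat.cast_nonneg N : (0 : ℝ) ≤ N))
    rw [trimmedMean, hsplit, empP_eq_card]
    linarith
  have hTp : 0 < T ^ p := rpow_pos_of_pos hT p
  have hfactor : lam * (T ^ p * q) ≤ 1 / (1 - lam) * ∫ ω in S, f ω ^ p ∂μ := by
    have : lam ≤ 1 / (1 - lam) := by
      rw [le_div_iff₀ hlam]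
      nlinarith
    exact mul_le_mul this htail (by positivity) (by positivity)
  have := mul_le_mul_of_nonneg_left hemp_le hTp.le
  linarith
end
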